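/- Let G be an ∞-spanned Coxeter group of rank n ≥ 3 which is not a free product ℤ₂ * ⋯ * ℤ₂, i.e. M i j ≠ 0 for at least one pair i ≠ j. Then the geodesic growth rate strictly dominates the word growth rate: γ(G) > ω(G). -/

import Mathlib

/-- A Coxeter matrix is `∞`-spanned if the simple graph on its index set, with an edge joining
`i ≠ j` exactly when `M i j = 0` (the label `∞`), is connected. -/
def CoxeterMatrix.InfSpanned {n : ℕ} (M : CoxeterMatrix (Fin n)) : Prop :=
  (SimpleGraph.fromRel (fun i j => M i j = 0)).Connected

/-- `w_k`: the number of elements of the Coxeter group of word length `k`. -/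
noncomputable def wordCount {n : ℕ} {W : Type*} [Group W] {M : CoxeterMatrix (Fin n)}
    (cs : CoxeterSystem M W) (k : ℕ) : ℕ :=
  Nat.card {g : W // cs.length g = k}

/-- `g_k`: the number of geodesic words of length `k`, i.e. tuples `(i_1, …, i_k)` such that
the word `s_{i_1} ⋯ s_{i_k}` is reduced. -/
noncomputable def geoCount {n : ℕ} {W : Type*} [Group W] {M : CoxeterMatrix (Fin n)}
    (cs : CoxeterSystem M W) (k : ℕ) : ℕ :=
  Nat.card {l : List (Fin n) // l.length = k ∧ cs.length (cs.wordProd l) = k}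

/-- The word growth rate `ω(G) = limsup_k w_k^(1/k)`. -/
noncomputable def wordGrowthRate {n : ℕ} {W : Type*} [Group W] {M : CoxeterMatrix (Fin n)}
    (cs : CoxeterSystem M W) : ℝ :=
  Filter.limsup (fun k : ℕ => (wordCount cs k : ℝ) ^ ((k : ℝ)⁻¹)) Filter.atTop

/-- The geodesic growth rate `γ(G) = limsup_k g_k^(1/k)`. -/
noncomputable def geoGrowthRate {n : ℕ} {W : Type*} [Group W] {M : CoxeterMatrix (Fin n)}
    (cs : CoxeterSystem M W) : ℝ :=
  Filter.limsup (fun k : ℕ => (geoCount cs k : ℝ) ^ ((k : ℝ)⁻¹)) Filter.atTop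

namespace CoxeterMatrix

open Real

set_option linter.unusedSectionVars false

variable {B : Type*} [Fintype B] [DecidableEq B]

/-- Entries of the Gram matrix of the deformed geometric representation: `-cos (π / m)` for a
finite label `m`, and `-κ` for the label `∞`. -/
noncomputable def gram (M : CoxeterMatrix B) (κ : ℝ) (i j : B) : ℝ :=
  if M i j = 0 then -κ else -cos (π / M i j)

/-- The pairing of a vector with the `i`-th simple root. -/
noncomputable def pairing (M : CoxeterMatrix B) (κ : ℝ) (i : B) : (B → ℝ) →ₗ[ℝ] ℝ :=
  ∑ j, M.gram κ i j • LinearMap.proj j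

/-- The bilinear form whose Gram matrix is `M.gram κ`. -/
noncomputable def form (M : CoxeterMatrix B) (κ : ℝ) (v w : B → ℝ) : ℝ :=
  ∑ i, w i * M.pairing κ i v

/-- The simple reflection `v ↦ v - 2 ⟨v, eᵢ⟩ eᵢ`. -/
noncomputable def simpleReflection (M : CoxeterMatrix B) (κ : ℝ) (i : B) :
    Module.End ℝ (B → ℝ) :=
  LinearMap.id - (2 : ℝ) • (M.pairing κ i).smulRight (Pi.single i 1)

/-- The Chebyshev-type sequence governing the action of a dihedral group on the plane spanned by
two simple roots. -/
noncomputable def dihedralCoeff (x : ℝ) : ℕ → ℝ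
  | 0 => 0
  | 1 => 1
  | k + 2 => 2 * x * dihedralCoeff x (k + 1) - dihedralCoeff x k

variable (M : CoxeterMatrix B) (κ : ℝ)

lemma gram_comm (i j : B) : M.gram κ i j = M.gram κ j i := by
  simp [gram, M.symmetric i j]

@[simp] lemma gram_self (i : B) : M.gram κ i i = 1 := by
  simp [gram]

lemma pairing_apply (i : B) (v : B → ℝ) : M.pairing κ i v = ∑ j, M.gram κ i j * v j := by
  simp [pairing]

@[simp] lemma pairing_single (i j : B) : M.pairing κ i (Pi.single j 1) = M.gram κ i j := by
  simp [pairing_apply, Pi.single_apply]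

lemma simpleReflection_apply (i : B) (v : B → ℝ) :
    M.simpleReflection κ i v = v - (2 * M.pairing κ i v) • Pi.single i (1 : ℝ) := by
  simp [simpleReflection, mul_smul]

lemma simpleReflection_single_self (i : B) :
    M.simpleReflection κ i (Pi.single i 1) = -Pi.single i (1 : ℝ) := by
  rw [simpleReflection_apply, pairing_single, gram_self]
  module

lemma pairing_simpleReflection (i j : B) (v : B → ℝ) :
    M.pairing κ j (M.simpleReflection κ i v)
      = M.pairing κ j v - 2 * M.pairing κ i v * M.gram κ j i := by
  simp [simpleReflection_apply]

lemma simpleReflection_mul_self (i : B) :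
    M.simpleReflection κ i * M.simpleReflection κ i = 1 := by
  refine LinearMap.ext fun v => ?_
  rw [Module.End.mul_apply, simpleReflection_apply _ _ _ (M.simpleReflection κ i v),
    pairing_simpleReflection, gram_self, simpleReflection_apply, Module.End.one_apply]
  module

lemma form_eq_sum (v w : B → ℝ) : M.form κ v w = ∑ i, ∑ j, M.gram κ i j * v j * w i := by
  simp only [form, pairing_apply, Finset.mul_sum]
  exact Finset.sum_congr rfl fun i _ => Finset.sum_congr rfl fun j _ => by ring

lemma form_comm (v w : B → ℝ) : M.form κ v w = M.form κ w v := by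
  rw [form_eq_sum, form_eq_sum, Finset.sum_comm]
  exact Finset.sum_congr rfl fun i _ => Finset.sum_congr rfl fun j _ => by
    rw [M.gram_comm κ j i]; ring

@[simp] lemma form_single_right (v : B → ℝ) (i : B) :
    M.form κ v (Pi.single i 1) = M.pairing κ i v := by
  simp [form, Pi.single_apply]

lemma form_sub_smul_right (v w u : B → ℝ) (a : ℝ) :
    M.form κ v (w - a • u) = M.form κ v w - a * M.form κ v u := by
  simp [form, sub_mul, Finset.sum_sub_distrib, Finset.mul_sum, mul_assoc]

lemma form_smul_sub_right (v w u : B → ℝ) (a : ℝ) :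
    M.form κ v (a • u - w) = a * M.form κ v u - M.form κ v w := by
  simp [form, sub_mul, Finset.sum_sub_distrib, Finset.mul_sum, mul_assoc]

lemma form_sub_smul_left (v w u : B → ℝ) (a : ℝ) :
    M.form κ (w - a • u) v = M.form κ w v - a * M.form κ u v := by
  rw [form_comm, form_sub_smul_right, form_comm, M.form_comm κ v u]

lemma form_simpleReflection (i : B) (v w : B → ℝ) :
    M.form κ (M.simpleReflection κ i v) (M.simpleReflection κ i w) = M.form κ v w := by
  simp only [simpleReflection_apply, form_sub_smul_right, form_sub_smul_left, form_single_right,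
    M.form_comm κ (Pi.single i 1), map_sub, map_smul, pairing_single, gram_self, smul_eq_mul]
  ring

lemma simpleReflection_combination (s t : B) (a b : ℝ) :
    M.simpleReflection κ t (a • Pi.single s (1 : ℝ) + b • Pi.single t (1 : ℝ))
      = a • Pi.single s (1 : ℝ) + (2 * -M.gram κ s t * a - b) • Pi.single t (1 : ℝ) := by
  rw [simpleReflection_apply]
  simp only [map_add, map_smul, pairing_single, gram_self, smul_eq_mul, M.gram_comm κ t s]
  module

lemma simpleReflection_combination' (s t : B) (a b : ℝ) :
    M.simpleReflection κ s (a • Pi.single s (1 : ℝ) + b • Pi.single t (1 : ℝ))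
      = (2 * -M.gram κ s t * b - a) • Pi.single s (1 : ℝ) + b • Pi.single t (1 : ℝ) := by
  rw [add_comm, simpleReflection_combination, M.gram_comm κ t s, add_comm]

lemma pow_mul_apply_single_left (s t : B) (k : ℕ) :
    ((M.simpleReflection κ s * M.simpleReflection κ t) ^ k) (Pi.single s 1)
      = dihedralCoeff (-M.gram κ s t) (2 * k + 1) • Pi.single s (1 : ℝ)
        + dihedralCoeff (-M.gram κ s t) (2 * k) • Pi.single t (1 : ℝ) := by
  induction k with
  | zero => simp [dihedralCoeff]
  | succ k ih =>
    rw [pow_succ', Module.End.mul_apply, ih, Module.End.mul_apply, simpleReflection_combination,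
      simpleReflection_combination']
    rfl

lemma pow_mul_apply_single_right (s t : B) (k : ℕ) :
    ((M.simpleReflection κ s * M.simpleReflection κ t) ^ (k + 1)) (Pi.single t 1)
      = (-dihedralCoeff (-M.gram κ s t) (2 * k + 2)) • Pi.single s (1 : ℝ)
        + (-dihedralCoeff (-M.gram κ s t) (2 * k + 1)) • Pi.single t (1 : ℝ) := by
  induction k with
  | zero =>
    have h := M.simpleReflection_combination' κ s t 0 (-1)
    simp only [zero_smul, zero_add, neg_smul, one_smul] at h
    rw [zero_add, pow_one, Module.End.mul_apply, simpleReflection_single_self, h]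
    simp [dihedralCoeff]
  | succ k ih =>
    rw [pow_succ', Module.End.mul_apply, ih, Module.End.mul_apply, simpleReflection_combination,
      simpleReflection_combination']
    have h₁ : dihedralCoeff (-M.gram κ s t) (2 * (k + 1) + 1) = 2 * -M.gram κ s t *
      dihedralCoeff (-M.gram κ s t) (2 * k + 2) - dihedralCoeff (-M.gram κ s t) (2 * k + 1) := rfl
    have h₂ : dihedralCoeff (-M.gram κ s t) (2 * (k + 1) + 2) = 2 * -M.gram κ s t *
      dihedralCoeff (-M.gram κ s t) (2 * (k + 1) + 1)
        - dihedralCoeff (-M.gram κ s t) (2 * k + 2) := rfl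
    rw [h₂, h₁]
    module

lemma dihedralCoeff_cos_mul_sin (θ : ℝ) (k : ℕ) :
    dihedralCoeff (cos θ) k * sin θ = sin (k * θ) := by
  induction k using Nat.twoStepInduction with
  | zero => simp [dihedralCoeff]
  | one => simp [dihedralCoeff]
  | more k h₀ h₁ =>
    have e₁ : ((k + 2 : ℕ) : ℝ) * θ = ((k + 1 : ℕ) : ℝ) * θ + θ := by push_cast; ring
    have e₀ : (k : ℝ) * θ = ((k + 1 : ℕ) : ℝ) * θ - θ := by push_cast; ring
    rw [e₀, sin_sub] at h₀
    rw [e₁, sin_add, dihedralCoeff, sub_mul, h₀, mul_assoc, h₁]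
    ring

lemma two_le_of_ne {i j : B} (hij : i ≠ j) (h : M i j ≠ 0) : 2 ≤ M i j := by
  have := M.off_diagonal i j hij
  omega

lemma sin_pi_div_pos {m : ℕ} (hm : 2 ≤ m) : 0 < sin (π / m) := by
  have hm' : (2 : ℝ) ≤ m := by exact_mod_cast hm
  apply sin_pos_of_pos_of_lt_pi (by positivity)
  rw [div_lt_iff₀ (by positivity)]
  nlinarith [pi_pos]

lemma isLiftable_simpleReflection : M.IsLiftable (M.simpleReflection κ) := by
  intro s t
  by_cases hst : s = t
  · subst hst
    simp [simpleReflection_mul_self]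
  by_cases hm : M s t = 0
  · simp [hm]
  have h2 := M.two_le_of_ne hst hm
  set θ : ℝ := π / M s t with hθ
  have hsin : 0 < sin θ := sin_pi_div_pos h2
  have hg : -M.gram κ s t = cos θ := by simp [gram, hm, hθ]
  have hmθ : (M s t : ℝ) * θ = π := by rw [hθ]; field_simp
  have hcoeff (k : ℕ) (a : ℝ) (h : sin (k * θ) = a * sin θ) : dihedralCoeff (cos θ) k = a :=
    mul_right_cancel₀ hsin.ne' ((dihedralCoeff_cos_mul_sin θ k).trans h)
  have c₀ : dihedralCoeff (cos θ) (2 * M s t) = 0 := hcoeff _ _ (by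
    push_cast; rw [mul_assoc, hmθ]; simp)
  have c₁ : dihedralCoeff (cos θ) (2 * M s t + 1) = 1 := hcoeff _ _ (by
    push_cast; rw [add_mul, mul_assoc, hmθ, add_comm]; simp)
  have c₂ : dihedralCoeff (cos θ) (2 * (M s t - 1) + 1) = -1 := hcoeff _ _ (by
    have : ((2 * (M s t - 1) + 1 : ℕ) : ℝ) * θ = 2 * π - θ := by
      rw [← hmθ]; push_cast [Nat.cast_sub (show 1 ≤ M s t by omega)]; ring
    rw [this, sin_two_pi_sub]; ring)
  have hs : ((M.simpleReflection κ s * M.simpleReflection κ t) ^ M s t) (Pi.single s 1)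
      = Pi.single s (1 : ℝ) := by
    rw [pow_mul_apply_single_left, hg, c₀, c₁]; simp
  have ht : ((M.simpleReflection κ s * M.simpleReflection κ t) ^ M s t) (Pi.single t 1)
      = Pi.single t (1 : ℝ) := by
    have e : M s t = M s t - 1 + 1 := by omega
    have e' : 2 * (M s t - 1) + 2 = 2 * M s t := by omega
    rw [e, pow_mul_apply_single_right, hg, c₂, e', c₀]; simp
  have hfix (v : B → ℝ) (h₁ : M.pairing κ s v = 0) (h₂ : M.pairing κ t v = 0) (k : ℕ) :
      ((M.simpleReflection κ s * M.simpleReflection κ t) ^ k) v = v := by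
    induction k with
    | zero => simp
    | succ k ih =>
      rw [pow_succ', Module.End.mul_apply, ih, Module.End.mul_apply]
      simp [simpleReflection_apply, h₁, h₂]
  refine LinearMap.ext fun v => ?_
  have hd : sin θ ^ 2 ≠ 0 := by positivity
  have hcs : cos θ ^ 2 = 1 - sin θ ^ 2 := by rw [cos_sq']
  set p := M.pairing κ s v
  set q := M.pairing κ t v
  set a := (p + cos θ * q) / sin θ ^ 2
  set b := (q + cos θ * p) / sin θ ^ 2
  have hgst : M.gram κ s t = -cos θ := by linarith
  have hw := hfix (v - a • Pi.single s (1 : ℝ) - b • Pi.single t (1 : ℝ))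
    (by
      simp only [map_sub, map_smul, pairing_single, gram_self, smul_eq_mul, hgst]
      change p - a * 1 - b * -cos θ = 0
      simp only [a, b]
      field_simp
      linear_combination (p : ℝ) * hcs)
    (by
      simp only [map_sub, map_smul, pairing_single, gram_self, smul_eq_mul, M.gram_comm κ t s, hgst]
      change q - a * -cos θ - b * 1 = 0
      simp only [a, b]
      field_simp
      linear_combination (q : ℝ) * hcs) (M s t)
  simp only [map_sub, map_smul, hs, ht] at hw
  rw [Module.End.one_apply]
  simpa using hw

end CoxeterMatrix

namespace CoxeterSystem

open CoxeterMatrix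

set_option linter.unusedSectionVars false

variable {B : Type*} [Fintype B] [DecidableEq B] {W : Type*} [Group W] {M : CoxeterMatrix B}
  (cs : CoxeterSystem M W) (κ : ℝ)

/-- The geometric representation of a Coxeter group, with parameter `κ` for the labels `∞`. -/
noncomputable def geomRep : W →* Module.End ℝ (B → ℝ) :=
  cs.lift ⟨M.simpleReflection κ, M.isLiftable_simpleReflection κ⟩

@[simp] lemma geomRep_simple (i : B) : cs.geomRep κ (cs.simple i) = M.simpleReflection κ i :=
  cs.lift_apply_simple _ i

lemma geomRep_mul_apply (w w' : W) (v : B → ℝ) :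
    cs.geomRep κ (w * w') v = cs.geomRep κ w (cs.geomRep κ w' v) := by
  rw [map_mul, Module.End.mul_apply]

@[simp] lemma geomRep_inv_apply (w : W) (v : B → ℝ) :
    cs.geomRep κ w⁻¹ (cs.geomRep κ w v) = v := by
  rw [← geomRep_mul_apply, inv_mul_cancel, map_one, Module.End.one_apply]

@[simp] lemma geomRep_apply_inv (w : W) (v : B → ℝ) :
    cs.geomRep κ w (cs.geomRep κ w⁻¹ v) = v := by
  rw [← geomRep_mul_apply, mul_inv_cancel, map_one, Module.End.one_apply]

lemma geomRep_eq_zero_iff {w : W} {v : B → ℝ} : cs.geomRep κ w v = 0 ↔ v = 0 := by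
  refine ⟨fun h => ?_, fun h => by simp [h]⟩
  rw [← cs.geomRep_inv_apply κ w v, h, map_zero]

lemma form_geomRep (w : W) (v u : B → ℝ) :
    M.form κ (cs.geomRep κ w v) (cs.geomRep κ w u) = M.form κ v u := by
  induction w using cs.simple_induction_left with
  | one => simp
  | mul_simple_left w i ih =>
    rw [geomRep_mul_apply, geomRep_mul_apply, geomRep_simple, form_simpleReflection, ih]

lemma dihedralCoeff_add_one_le {x : ℝ} (hx : 1 ≤ x) (k : ℕ) :
    0 ≤ dihedralCoeff x k ∧ dihedralCoeff x k + 1 ≤ dihedralCoeff x (k + 1) := by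
  induction k with
  | zero => simp [dihedralCoeff]
  | succ k ih =>
    refine ⟨by linarith, ?_⟩
    rw [dihedralCoeff]
    nlinarith

lemma dihedralCoeff_nonneg (hκ : 1 ≤ κ) {s t : B} (hst : s ≠ t) {k : ℕ}
    (hk : M s t ≠ 0 → k ≤ M s t) : 0 ≤ dihedralCoeff (-M.gram κ s t) k := by
  by_cases hm : M s t = 0
  · have : -M.gram κ s t = κ := by simp [gram, hm]
    rw [this]
    exact (dihedralCoeff_add_one_le hκ k).1
  · have h2 := M.two_le_of_ne hst hm
    have hg : -M.gram κ s t = Real.cos (Real.pi / M s t) := by simp [gram, hm]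
    have hsin := sin_pi_div_pos h2
    rw [hg]
    refine nonneg_of_mul_nonneg_left ?_ hsin
    rw [dihedralCoeff_cos_mul_sin]
    apply Real.sin_nonneg_of_nonneg_of_le_pi (by positivity)
    have : (k : ℝ) ≤ M s t := by exact_mod_cast hk hm
    have hpos : (0 : ℝ) < M s t := by positivity
    rw [mul_div_assoc', div_le_iff₀ hpos]
    nlinarith [Real.pi_pos]

lemma geomRep_alternatingWord (s t : B) (k : ℕ) :
    cs.geomRep κ (cs.wordProd (alternatingWord s t k)) (Pi.single s 1)
      = dihedralCoeff (-M.gram κ s t) (if Even k then k + 1 else k) • Pi.single s (1 : ℝ)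
        + dihedralCoeff (-M.gram κ s t) (if Even k then k else k + 1) • Pi.single t (1 : ℝ) := by
  induction k with
  | zero => simp [alternatingWord, dihedralCoeff]
  | succ k ih =>
    rw [alternatingWord_succ', wordProd_cons, geomRep_mul_apply, ih, geomRep_simple]
    by_cases hk : Even k
    · have hk' : ¬ Even (k + 1) := by simpa [Nat.even_add_one] using hk
      simp only [hk, hk', if_true, if_false]
      rw [simpleReflection_combination]
      rfl
    · have hk' : Even (k + 1) := by simpa [Nat.even_add_one] using hk
      simp only [hk, hk', if_true, if_false]
      rw [simpleReflection_combination']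
      rfl

lemma exists_nonneg_geomRep_alternatingWord (hκ : 1 ≤ κ) {s t : B} (hst : s ≠ t) {k : ℕ}
    (hk : M s t ≠ 0 → k + 1 ≤ M s t) : ∃ a b : ℝ, 0 ≤ a ∧ 0 ≤ b ∧
      cs.geomRep κ (cs.wordProd (alternatingWord s t k)) (Pi.single s 1)
        = a • Pi.single s (1 : ℝ) + b • Pi.single t (1 : ℝ) := by
  refine ⟨_, _, ?_, ?_, cs.geomRep_alternatingWord κ s t k⟩ <;>
  · apply dihedralCoeff_nonneg κ hκ hst
    intro h
    have := hk h
    split_ifs <;> omega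

lemma single_nonneg (i : B) : (0 : B → ℝ) ≤ Pi.single i 1 :=
  Pi.single_nonneg.2 zero_le_one

theorem geomRep_single_nonneg (hκ : 1 ≤ κ) {w : W} {s : B} (hs : ¬ cs.IsRightDescent w s) :
    0 ≤ cs.geomRep κ w (Pi.single s 1) := by
  induction hw : cs.length w using Nat.strong_induction_on generalizing w s with
  | _ N ih =>
  subst hw
  by_cases h1 : w = 1
  · simp [h1]
  obtain ⟨t, ht⟩ := cs.exists_rightDescent_of_ne_one h1
  have hst : s ≠ t := fun h => hs (h ▸ ht)
  let f : ℕ → W := fun k => w * (cs.wordProd (alternatingWord s t k))⁻¹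
  have hf_succ (k : ℕ) : f (k + 1) = f k * cs.simple (if Even k then t else s) := by
    simp only [f, alternatingWord_succ', wordProd_cons, mul_inv_rev, inv_simple, mul_assoc]
  have hf_le (k : ℕ) : cs.length w ≤ cs.length (f k) + k := by
    have h := cs.length_le_length_mul_add_right w (cs.wordProd (alternatingWord s t k))⁻¹
    have h' := cs.length_wordProd_le (alternatingWord s t k)
    rw [length_alternatingWord] at h'
    rw [length_inv] at h
    simp only [f]
    omega
  let P : ℕ → Prop := fun k => cs.length (f k) + k = cs.length w
  have hf0 : f 0 = w := by simp [f, alternatingWord]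
  have hP1 : P 1 := by
    have := cs.isRightDescent_iff.1 ht
    have h := hf_succ 0
    simp only [zero_add, hf0, Even.zero, if_true] at h
    simp only [P, h]
    omega
  classical
  obtain ⟨k, hk, hk', hk1⟩ : ∃ k, P k ∧ ¬ P (k + 1) ∧ 1 ≤ k := by
    have hle : 1 ≤ cs.length w := by simp only [P] at hP1; omega
    refine ⟨Nat.findGreatest P (cs.length w), Nat.findGreatest_spec hle hP1, fun h => ?_,
      Nat.le_findGreatest hle hP1⟩
    have h2 : Nat.findGreatest P (cs.length w) + 1 ≤ cs.length w :=
      (Nat.le_add_left _ _).trans_eq h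
    exact absurd (Nat.le_findGreatest h2 h) (by omega)
  obtain ⟨j, rfl⟩ : ∃ j, k = j + 1 := ⟨k - 1, by omega⟩
  simp only [P] at hk hk'
  have d₁ : ¬ cs.IsRightDescent (f (j + 1)) (if Even (j + 1) then t else s) := by
    rw [isRightDescent_iff, ← hf_succ]
    omega
  have d₂ : ¬ cs.IsRightDescent (f (j + 1)) (if Even j then t else s) := by
    rw [isRightDescent_iff]
    nth_rw 1 [hf_succ j]
    rw [simple_mul_simple_cancel_right]
    have := hf_le j
    omega
  have hds : ¬ cs.IsRightDescent (f (j + 1)) s ∧ ¬ cs.IsRightDescent (f (j + 1)) t := by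
    by_cases hj : Even j
    · have hj' : ¬ Even (j + 1) := by simpa [Nat.even_add_one] using hj
      simp only [hj, hj', if_true, if_false] at d₁ d₂
      exact ⟨d₁, d₂⟩
    · have hj' : Even (j + 1) := by simpa [Nat.even_add_one] using hj
      simp only [hj, hj', if_true, if_false] at d₁ d₂
      exact ⟨d₂, d₁⟩
  have hlt : cs.length (f (j + 1)) < cs.length w := by omega
  have ps := ih _ hlt hds.1 rfl
  have pt := ih _ hlt hds.2 rfl
  have hbound : M s t ≠ 0 → (j + 1) + 1 ≤ M s t := by
    intro hm
    by_contra hcon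
    rw [M.symmetric] at hm hcon
    apply cs.not_isReduced_alternatingWord t s hm (m := j + 1 + 1) (by omega)
    have hprod : f (j + 1) * cs.wordProd (alternatingWord t s (j + 1 + 1))
        = w * cs.simple s := by
      rw [alternatingWord_succ t s, wordProd_concat, ← mul_assoc]
      simp [f]
    have h₁ := cs.length_mul_le (f (j + 1)) (cs.wordProd (alternatingWord t s (j + 1 + 1)))
    have h₂ := cs.length_wordProd_le (alternatingWord t s (j + 1 + 1))
    rw [hprod, (cs.not_isRightDescent_iff).1 hs] at h₁
    rw [length_alternatingWord] at h₂
    rw [IsReduced, length_alternatingWord]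
    omega
  obtain ⟨a, b, ha, hb, hab⟩ := cs.exists_nonneg_geomRep_alternatingWord κ hκ hst hbound
  have hw : w = f (j + 1) * cs.wordProd (alternatingWord s t (j + 1)) := by simp [f]
  rw [hw, geomRep_mul_apply, hab, map_add, map_smul, map_smul]
  exact add_nonneg (smul_nonneg ha ps) (smul_nonneg hb pt)

theorem geomRep_single_nonpos (hκ : 1 ≤ κ) {w : W} {s : B} (hs : cs.IsRightDescent w s) :
    cs.geomRep κ w (Pi.single s 1) ≤ 0 := by
  have h := cs.geomRep_single_nonneg κ hκ (cs.isRightDescent_iff_not_isRightDescent_mul.1 hs)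
  rw [geomRep_mul_apply, geomRep_simple, simpleReflection_single_self, map_neg] at h
  exact neg_nonneg.1 h

lemma not_isRightDescent_of_nonneg (hκ : 1 ≤ κ) {w : W} {s : B}
    (h : 0 ≤ cs.geomRep κ w (Pi.single s 1)) : ¬ cs.IsRightDescent w s := by
  intro hs
  have h0 := le_antisymm (cs.geomRep_single_nonpos κ hκ hs) h
  rw [geomRep_eq_zero_iff] at h0
  simpa using congrFun h0 s

/-- The roots of the geometric representation. -/
def IsRoot (v : B → ℝ) : Prop := ∃ w i, v = cs.geomRep κ w (Pi.single i 1)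

variable {cs κ}

lemma isRoot_single (i : B) : cs.IsRoot κ (Pi.single i 1) := ⟨1, i, by simp⟩

lemma IsRoot.map {v : B → ℝ} (hv : cs.IsRoot κ v) (w : W) : cs.IsRoot κ (cs.geomRep κ w v) := by
  obtain ⟨w', i, rfl⟩ := hv
  exact ⟨w * w', i, (cs.geomRep_mul_apply κ _ _ _).symm⟩

lemma IsRoot.neg {v : B → ℝ} (hv : cs.IsRoot κ v) : cs.IsRoot κ (-v) := by
  obtain ⟨w, i, rfl⟩ := hv
  refine ⟨w * cs.simple i, i, ?_⟩
  rw [geomRep_mul_apply, geomRep_simple, simpleReflection_single_self, map_neg]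

lemma IsRoot.form_self {v : B → ℝ} (hv : cs.IsRoot κ v) : M.form κ v v = 1 := by
  obtain ⟨w, i, rfl⟩ := hv
  simp [form_geomRep]

lemma IsRoot.ne_zero {v : B → ℝ} (hv : cs.IsRoot κ v) : v ≠ 0 := by
  rintro rfl
  simpa [form] using hv.form_self

lemma IsRoot.nonneg_or_nonpos (hκ : 1 ≤ κ) {v : B → ℝ} (hv : cs.IsRoot κ v) : 0 ≤ v ∨ v ≤ 0 := by
  obtain ⟨w, i, rfl⟩ := hv
  by_cases h : cs.IsRightDescent w i
  · exact Or.inr (cs.geomRep_single_nonpos κ hκ h)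
  · exact Or.inl (cs.geomRep_single_nonneg κ hκ h)

lemma IsRoot.smul_sub {α β : B → ℝ} (hα : cs.IsRoot κ α) (hβ : cs.IsRoot κ β) :
    cs.IsRoot κ ((2 * M.form κ α β) • β - α) := by
  obtain ⟨w, i, rfl⟩ := hβ
  have h := ((hα.map w⁻¹).map (cs.simple i)).map w
  rw [geomRep_simple, simpleReflection_apply, map_sub, map_smul, geomRep_apply_inv,
    ← form_single_right, ← cs.form_geomRep κ w, geomRep_apply_inv] at h
  simpa using h.neg

lemma IsRoot.eq_single {v : B → ℝ} (hv : cs.IsRoot κ v) (h : 0 ≤ v) {i : B}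
    (hi : M.simpleReflection κ i v ≤ 0) : v = Pi.single i 1 := by
  have h0 : ∀ j ≠ i, v j = 0 := by
    intro j hj
    have := hi j
    simp only [simpleReflection_apply, Pi.sub_apply, Pi.smul_apply, Pi.single_eq_of_ne hj,
      smul_zero, sub_zero, Pi.zero_apply] at this
    exact le_antisymm this (h j)
  have hv' : v = v i • Pi.single i (1 : ℝ) := by
    ext j
    by_cases hj : j = i
    · subst hj; simp
    · simp [h0 j hj, hj]
  have h1 := hv.form_self
  have h2 : M.form κ v v = v i * v i := by
    rw [form, Finset.sum_eq_single i (fun j _ hj => by simp [h0 j hj]) (by simp)]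
    nth_rw 2 [hv']
    simp
  have h3 : v i = 1 := by
    have := h i
    simp only [Pi.zero_apply] at this
    nlinarith
  rw [hv', h3, one_smul]

variable (cs κ)

lemma finite_setOf_isRoot_inversion (hκ : 1 ≤ κ) (w : W) :
    {v | cs.IsRoot κ v ∧ 0 ≤ v ∧ cs.geomRep κ w v ≤ 0}.Finite := by
  induction w using cs.simple_induction_right with
  | one =>
    refine Set.finite_empty.subset ?_
    rintro v ⟨hv, h0, h1⟩
    rw [map_one, Module.End.one_apply] at h1
    exact hv.ne_zero (le_antisymm h1 h0)
  | mul_simple_right w i ih =>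
    refine ((ih.image (M.simpleReflection κ i)).insert (Pi.single i 1)).subset ?_
    rintro v ⟨hv, h0, h1⟩
    rw [geomRep_mul_apply, geomRep_simple] at h1
    have hr := hv.map (cs.simple i)
    rw [geomRep_simple] at hr
    rcases hr.nonneg_or_nonpos hκ with h | h
    · refine Or.inr ⟨_, ⟨hr, h, h1⟩, ?_⟩
      rw [← Module.End.mul_apply, simpleReflection_mul_self, Module.End.one_apply]
    · exact Or.inl (hv.eq_single h0 h)

variable {κ}

/-- Two roots with pairing at least `1` generate infinitely many roots in a half-strip, so an
element of the group cannot separate them in the direction described here. -/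
lemma not_inversion_of_one_le_form (hκ : 1 ≤ κ) {w : W} {α β : B → ℝ} (hα : cs.IsRoot κ α)
    (hβ : cs.IsRoot κ β) (hαβ : 1 ≤ M.form κ α β) (hwα : 0 ≤ cs.geomRep κ w α)
    {i : B} (hαi : α i ≤ 0) (hβi : 0 < β i) : ¬ cs.geomRep κ w β ≤ 0 := by
  intro hwβ
  set b := M.form κ α β with hb
  let p := dihedralCoeff b
  have hp := dihedralCoeff_add_one_le hαβ
  let y : ℕ → B → ℝ := fun k => p (k + 1) • β - p k • α
  have hy (k : ℕ) : y (k + 2) = (2 * b) • y (k + 1) - y k := by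
    have e₁ : p (k + 2) = 2 * b * p (k + 1) - p k := rfl
    have e₂ : p (k + 3) = 2 * b * p (k + 2) - p (k + 1) := rfl
    simp only [y, e₂]
    rw [show k + 1 + 1 = k + 2 from rfl, e₁]
    module
  have hroot (k : ℕ) : cs.IsRoot κ (y k) ∧ cs.IsRoot κ (y (k + 1)) ∧
      M.form κ (y k) (y (k + 1)) = b := by
    induction k with
    | zero =>
      have e₀ : y 0 = β := by simp [y, p, dihedralCoeff]
      have e₁ : y 1 = (2 * b) • β - α := by simp [y, p, dihedralCoeff]
      rw [e₀, e₁, form_smul_sub_right, hβ.form_self, M.form_comm κ β α, ← hb]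
      exact ⟨hβ, hα.smul_sub hβ, by ring⟩
    | succ k ih =>
      obtain ⟨h₀, h₁, h₂⟩ := ih
      refine ⟨h₁, ?_, ?_⟩
      · have := h₀.smul_sub h₁
        rwa [h₂, ← hy] at this
      · rw [show k + 1 + 1 = k + 2 from rfl, hy, form_smul_sub_right, h₁.form_self,
          M.form_comm κ _ (y k), h₂]
        ring
  have hyi (k : ℕ) : y k i = p (k + 1) * β i - p k * α i := by simp [y]
  have hmono : StrictMono fun k => y k i := by
    refine strictMono_nat_of_lt_succ fun k => ?_
    have h₁ := hp k
    have h₂ := hp (k + 1)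
    simp only [hyi]
    change p (k + 1) * β i - p k * α i < p (k + 2) * β i - p (k + 1) * α i
    have h₁' : p k + 1 ≤ p (k + 1) := h₁.2
    have h₂' : p (k + 1) + 1 ≤ p (k + 2) := h₂.2
    nlinarith
  have hinj : Function.Injective y := fun k l h => hmono.injective (congrFun h i)
  refine Set.infinite_of_injective_forall_mem hinj (fun k => ?_)
    (cs.finite_setOf_isRoot_inversion κ hκ w)
  have h₁ : 0 ≤ p k := (hp k).1
  have h₂ : 1 ≤ p (k + 1) := by have := (hp k).2; simp only [p]; linarith
  refine ⟨(hroot k).1, ?_, ?_⟩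
  · refine ((hroot k).1.nonneg_or_nonpos hκ).resolve_right fun h => ?_
    have := h i
    rw [hyi, Pi.zero_apply] at this
    nlinarith
  · simp only [y, map_sub, map_smul]
    exact sub_nonpos.2 ((smul_nonpos_of_nonneg_of_nonpos (by linarith) hwβ).trans
      (smul_nonneg h₁ hwα))

lemma pairing_lt_one (hκ : 1 ≤ κ) {w : W} {v : B → ℝ} (hv : cs.IsRoot κ v) (h0 : 0 ≤ v)
    (hwv : cs.geomRep κ w v ≤ 0) {t : B} (ht : ¬ cs.IsRightDescent w t) :
    M.pairing κ t v < 1 := by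
  by_contra! hcon
  have hwt := cs.geomRep_single_nonneg κ hκ ht
  obtain ⟨i, hit, hi⟩ : ∃ i ≠ t, 0 < v i := by
    by_contra! hall
    have hv' : v = v t • Pi.single t (1 : ℝ) := by
      ext j
      by_cases hj : j = t
      · subst hj; simp
      · simp [hj, le_antisymm (hall j hj) (h0 j)]
    have : 0 ≤ cs.geomRep κ w v := by
      rw [hv', map_smul]
      exact smul_nonneg (h0 t) hwt
    exact hv.ne_zero ((cs.geomRep_eq_zero_iff κ).1 (le_antisymm hwv this))
  refine cs.not_inversion_of_one_le_form hκ (isRoot_single t) hv ?_ hwt (i := i) ?_ hi hwv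
  · rwa [form_comm, form_single_right]
  · simp [hit]

lemma not_isRightDescent_of_isRightDescent {w : W} {s t : B} (hst : M s t = 0)
    (hs : cs.IsRightDescent w s) : ¬ cs.IsRightDescent w t := by
  intro ht
  have hne : s ≠ t := by rintro rfl; simp at hst
  have h₁ := cs.geomRep_single_nonpos 1 le_rfl hs
  have h₂ := cs.geomRep_single_nonpos 1 le_rfl ht
  refine cs.not_inversion_of_one_le_form le_rfl (isRoot_single t).neg (isRoot_single s) ?_ ?_
    (i := s) ?_ ?_ h₁
  · rw [form_single_right, map_neg, pairing_single]
    simp [gram, hst]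
  · rw [map_neg]
    exact neg_nonneg.2 h₂
  · simp [hne]
  · simp

end CoxeterSystem

/-- Real functions given by a polynomial. -/
def IsPolynomialFun (f : ℝ → ℝ) : Prop := ∃ P : Polynomial ℝ, ∀ x, f x = P.eval x

namespace IsPolynomialFun

lemma const (a : ℝ) : IsPolynomialFun fun _ => a := ⟨Polynomial.C a, by simp⟩

lemma id : IsPolynomialFun fun x => x := ⟨Polynomial.X, by simp⟩

lemma add {f g : ℝ → ℝ} (hf : IsPolynomialFun f) (hg : IsPolynomialFun g) :
    IsPolynomialFun fun x => f x + g x := by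
  obtain ⟨P, hP⟩ := hf
  obtain ⟨Q, hQ⟩ := hg
  exact ⟨P + Q, by simp [hP, hQ]⟩

lemma mul {f g : ℝ → ℝ} (hf : IsPolynomialFun f) (hg : IsPolynomialFun g) :
    IsPolynomialFun fun x => f x * g x := by
  obtain ⟨P, hP⟩ := hf
  obtain ⟨Q, hQ⟩ := hg
  exact ⟨P * Q, by simp [hP, hQ]⟩

lemma sum {ι : Type*} (s : Finset ι) {f : ι → ℝ → ℝ} (hf : ∀ i, IsPolynomialFun (f i)) :
    IsPolynomialFun fun x => ∑ i ∈ s, f i x := by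
  choose P hP using hf
  exact ⟨∑ i ∈ s, P i, by simp [hP, Polynomial.eval_finsetSum]⟩

lemma eq_zero_of_abs_mul_le {f : ℝ → ℝ} (hf : IsPolynomialFun f) {C : ℝ}
    (h : ∀ x, 1 ≤ x → |x * f x| ≤ C) (x : ℝ) : f x = 0 := by
  obtain ⟨P, hP⟩ := hf
  have hdeg : (Polynomial.X * P).degree ≤ 0 := by
    rw [← Polynomial.isBoundedUnder_abs_atTop_iff]
    refine ⟨C, Filter.eventually_map.2 ?_⟩
    filter_upwards [Filter.eventually_ge_atTop 1] with y hy
    simpa [hP] using h y hy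
  have hP0 : P = 0 := by
    by_contra hne
    rw [Polynomial.degree_mul, Polynomial.degree_X, Polynomial.degree_eq_natDegree hne] at hdeg
    have : (1 + P.natDegree : ℕ) ≤ 0 := by exact_mod_cast hdeg
    omega
  simp [hP, hP0]

end IsPolynomialFun

/-- The word obtained from a walk by replacing each step `a → b` with the letters `babab`. -/
def SimpleGraph.Walk.zigzag {V : Type*} {G : SimpleGraph V} : ∀ {a d : V}, G.Walk a d → List V
  | _, _, .nil => []
  | a, _, .cons (v := b) _ p => b :: a :: b :: a :: b :: p.zigzag

namespace SimpleGraph.Walk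

variable {V : Type*} {G : SimpleGraph V}

lemma isChain_zigzag {a d : V} (p : G.Walk a d) : (a :: p.zigzag).IsChain G.Adj := by
  induction p with
  | nil => simp [zigzag]
  | cons h p ih => simp [zigzag, h, h.symm, ih]

lemma getLast?_zigzag {a d : V} (p : G.Walk a d) : (a :: p.zigzag).getLast? = some d := by
  induction p with
  | nil => simp [zigzag]
  | cons h p ih => simpa [zigzag] using ih

end SimpleGraph.Walk

lemma SimpleGraph.Connected.exists_walk_support {V : Type*} [Finite V] {G : SimpleGraph V}
    (hG : G.Connected) (a d : V) : ∃ p : G.Walk a d, ∀ v, v ∈ p.support := by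
  classical
  have := Fintype.ofFinite V
  suffices h : ∀ s : Finset V, ∀ a, ∃ p : G.Walk a d, ∀ v ∈ s, v ∈ p.support by
    obtain ⟨p, hp⟩ := h Finset.univ a
    exact ⟨p, fun v => hp v (Finset.mem_univ v)⟩
  intro s
  induction s using Finset.induction_on with
  | empty => exact fun a => ⟨(hG.preconnected a d).some, by simp⟩
  | insert v s _ ih =>
    intro a
    obtain ⟨p, hp⟩ := ih v
    refine ⟨(hG.preconnected a v).some.append p, fun u hu => ?_⟩
    rw [SimpleGraph.Walk.mem_support_append_iff]
    rcases Finset.mem_insert.1 hu with rfl | hu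
    · simp
    · exact Or.inr (hp u hu)

namespace CoxeterSystem

open CoxeterMatrix

set_option linter.unusedSectionVars false

variable {B : Type*} [Fintype B] [DecidableEq B] {W : Type*} [Group W] {M : CoxeterMatrix B}
  {cs : CoxeterSystem M W}

lemma IsReduced.of_append_left {l l' : List B} (h : cs.IsReduced (l ++ l')) : cs.IsReduced l := by
  simpa using h.take l.length

lemma IsReduced.of_append_right {l l' : List B} (h : cs.IsReduced (l ++ l')) :
    cs.IsReduced l' := by
  simpa using h.drop l.length

lemma IsReduced.of_infix {l l' : List B} (h : cs.IsReduced l) (hl : l' <:+: l) :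
    cs.IsReduced l' := by
  obtain ⟨a, b, rfl⟩ := hl
  exact h.of_append_left.of_append_right

lemma isReduced_append_singleton_iff {l : List B} {i : B} :
    cs.IsReduced (l ++ [i]) ↔ cs.IsReduced l ∧ ¬ cs.IsRightDescent (cs.wordProd l) i := by
  have hprod : cs.wordProd (l ++ [i]) = cs.wordProd l * cs.simple i := by simp [wordProd_append]
  constructor
  · intro h
    have hl : cs.IsReduced l := h.of_append_left
    refine ⟨hl, ?_⟩
    rw [not_isRightDescent_iff, ← hprod, h.eq, hl.eq]
    simp
  · rintro ⟨hl, hi⟩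
    rw [IsReduced, hprod, (cs.not_isRightDescent_iff).1 hi, hl.eq]
    simp

lemma IsReduced.isRightDescent {l : List B} {i : B} (h : cs.IsReduced (l ++ [i])) :
    cs.IsRightDescent (cs.wordProd (l ++ [i])) i := by
  rw [isRightDescent_iff, h.eq, wordProd_append, wordProd_singleton,
    simple_mul_simple_cancel_right, h.of_append_left.eq]
  simp

lemma IsReduced.append_isChain {l u : List B} {a : B} (hl : cs.IsReduced l)
    (ha : l.getLast? = some a) (hu : (a :: u).IsChain fun i j => M i j = 0) :
    cs.IsReduced (l ++ u) := by
  induction u generalizing l a with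
  | nil => simpa using hl
  | cons b u ih =>
    obtain ⟨l, rfl⟩ := List.getLast?_eq_some_iff.1 ha
    rw [List.isChain_cons_cons] at hu
    have h := isReduced_append_singleton_iff.2
      ⟨hl, cs.not_isRightDescent_of_isRightDescent hu.1 hl.isRightDescent⟩
    simpa using ih h (by simp) hu.2

lemma IsReduced.isChain_append {l u : List B} {b : B} (hl : cs.IsReduced l)
    (hb : l.head? = some b) (hu : (u ++ [b]).IsChain fun i j => M i j = 0) :
    cs.IsReduced (u ++ l) := by
  rw [← isReduced_reverse_iff, List.reverse_append]
  refine hl.reverse.append_isChain (a := b) (by simpa using hb) ?_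
  have h : (u ++ [b]).reverse.IsChain fun i j => M i j = 0 :=
    List.isChain_reverse.2 (hu.imp fun i j h => (M.symmetric j i).trans h)
  simpa using h

variable (M) in
lemma isPolynomialFun_gram (i j : B) : IsPolynomialFun fun κ => M.gram κ i j := by
  unfold gram
  split_ifs
  · simpa using (IsPolynomialFun.const (-1)).mul .id
  · exact .const _

variable (M) in
lemma isPolynomialFun_pairing {v : ℝ → B → ℝ} (hv : ∀ j, IsPolynomialFun fun κ => v κ j) (i : B) :
    IsPolynomialFun fun κ => M.pairing κ i (v κ) := by
  simp only [pairing_apply]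
  exact .sum _ fun j => (isPolynomialFun_gram M i j).mul (hv j)

variable (cs) in
lemma isPolynomialFun_geomRep (l : List B) {v : ℝ → B → ℝ}
    (hv : ∀ j, IsPolynomialFun fun κ => v κ j) (j : B) :
    IsPolynomialFun fun κ => cs.geomRep κ (cs.wordProd l) (v κ) j := by
  induction l generalizing j with
  | nil => simpa using hv j
  | cons i l ih =>
    simp only [wordProd_cons, geomRep_mul_apply, geomRep_simple, simpleReflection_apply,
      Pi.sub_apply, Pi.smul_apply, smul_eq_mul]
    have h := (ih j).add
      (((isPolynomialFun_pairing M ih i).mul (.const (-2))).mul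
        (.const ((Pi.single i (1 : ℝ) : B → ℝ) j)))
    convert h using 2
    ring

variable (cs) in
/-- If a polynomial family of vectors keeps bounded pairings with the letters of a zigzag word
while that word acts on it, then it is orthogonal to all the letters. -/
lemma pairing_eq_zero_of_zigzag {G : SimpleGraph B} (hG : ∀ i j, G.Adj i j → M i j = 0)
    {v : ℝ → B → ℝ} (hv : ∀ j, IsPolynomialFun fun κ => v κ j) {a d : B} (p : G.Walk a d)
    (hp : ∀ u₁ t u₂, p.zigzag = u₁ ++ t :: u₂ → ∀ κ, 1 ≤ κ →
      |M.pairing κ t (cs.geomRep κ (cs.wordProd u₂) (v κ))| < 1) :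
    ∀ κ, 1 ≤ κ → cs.geomRep κ (cs.wordProd p.zigzag) (v κ) = v κ ∧
      (¬ p.Nil → ∀ r ∈ p.support, M.pairing κ r (v κ) = 0) := by
  induction p with
  | nil => simp [SimpleGraph.Walk.zigzag]
  | @cons a b d hab p ih =>
    have ih' := ih fun u₁ t u₂ h => hp (b :: a :: b :: a :: b :: u₁) t u₂ (by
      simp [SimpleGraph.Walk.zigzag, h])
    have hM := hG a b hab
    have gab (κ : ℝ) : M.gram κ a b = -κ := by simp [gram, hM]
    have gba (κ : ℝ) : M.gram κ b a = -κ := by rw [gram_comm, gab]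
    let q : ℝ → ℝ := fun κ => M.pairing κ b (v κ)
    let r : ℝ → ℝ := fun κ => M.pairing κ a (v κ) + 2 * κ * q κ
    have hq : IsPolynomialFun q := isPolynomialFun_pairing M hv b
    have hr : IsPolynomialFun r :=
      (isPolynomialFun_pairing M hv a).add (((IsPolynomialFun.const 2).mul .id).mul hq)
    have b₁ (κ : ℝ) (hκ : 1 ≤ κ) : |q κ| < 1 := by
      simpa only [(ih' κ hκ).1] using hp [b, a, b, a] b p.zigzag rfl κ hκ
    have b₃ (κ : ℝ) (hκ : 1 ≤ κ) : |2 * κ * r κ - q κ| < 1 := by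
      have := hp [b, a] b (a :: b :: p.zigzag) rfl κ hκ
      simp only [wordProd_cons, geomRep_mul_apply, geomRep_simple, pairing_simpleReflection,
        (ih' κ hκ).1, gab, gba, gram_self] at this
      convert this using 2
      simp only [r, q]
      ring
    have b₄ (κ : ℝ) (hκ : 1 ≤ κ) : |2 * κ * (2 * κ * r κ - q κ) - r κ| < 1 := by
      have := hp [b] a (b :: a :: b :: p.zigzag) rfl κ hκ
      simp only [wordProd_cons, geomRep_mul_apply, geomRep_simple, pairing_simpleReflection,
        (ih' κ hκ).1, gab, gba, gram_self] at this
      convert this using 2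
      simp only [r, q]
      ring
    have hr0 : ∀ κ, r κ = 0 := hr.eq_zero_of_abs_mul_le (C := 1) fun κ hκ => by
      have h₁ := abs_lt.1 (b₁ κ hκ)
      have h₃ := abs_lt.1 (b₃ κ hκ)
      exact abs_le.2 ⟨by linarith, by linarith⟩
    have hq0 : ∀ κ, q κ = 0 := hq.eq_zero_of_abs_mul_le (C := 1) fun κ hκ => by
      have h₄ := abs_lt.1 (b₄ κ hκ)
      rw [hr0] at h₄
      exact abs_le.2 ⟨by linarith, by linarith⟩
    intro κ hκ
    have hb : M.pairing κ b (v κ) = 0 := hq0 κ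
    have ha : M.pairing κ a (v κ) = 0 := by
      have := hr0 κ
      simpa [r, hq0 κ] using this
    have fb : M.simpleReflection κ b (v κ) = v κ := by simp [simpleReflection_apply, hb]
    have fa : M.simpleReflection κ a (v κ) = v κ := by simp [simpleReflection_apply, ha]
    refine ⟨?_, fun _ i hi => ?_⟩
    · simp only [SimpleGraph.Walk.zigzag, wordProd_cons, geomRep_mul_apply, geomRep_simple,
        (ih' κ hκ).1, fa, fb]
    · rw [SimpleGraph.Walk.support_cons, List.mem_cons] at hi
      rcases hi with rfl | hi
      · exact ha
      · by_cases hn : p.Nil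
        · cases p with
          | nil => simp at hi; rwa [hi]
          | cons => simp at hn
        · exact (ih' κ hκ).2 hn i hi

/-- The zigzag word of a covering walk along labels `∞` glues reduced words. -/
theorem IsReduced.append_zigzag_append {G : SimpleGraph B} (hG : ∀ i j, G.Adj i j → M i j = 0)
    {a d : B} {p : G.Walk a d} (hp : ∀ i, i ∈ p.support) (hnil : ¬ p.Nil) {x y : List B}
    (hx : cs.IsReduced (x ++ p.zigzag)) (hy : cs.IsReduced (p.zigzag ++ y)) :
    cs.IsReduced (x ++ p.zigzag ++ y) := by
  induction y using List.reverseRecOn with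
  | nil => simpa using hx
  | append_singleton y c ih =>
    have hyc : cs.IsReduced (p.zigzag ++ y) := by
      rw [← List.append_assoc] at hy
      exact hy.of_append_left
    rw [← List.append_assoc, isReduced_append_singleton_iff]
    refine ⟨ih hyc, fun hdesc => ?_⟩
    let v : ℝ → B → ℝ := fun κ => cs.geomRep κ (cs.wordProd y) (Pi.single c 1)
    have hv : ∀ j, IsPolynomialFun fun κ => v κ j :=
      cs.isPolynomialFun_geomRep y fun j => .const _
    have key : ∀ u₁ t u₂, p.zigzag = u₁ ++ t :: u₂ → ∀ κ, 1 ≤ κ →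
        |M.pairing κ t (cs.geomRep κ (cs.wordProd u₂) (v κ))| < 1 := by
      intro u₁ t u₂ hu κ hκ
      have hsuffix : cs.IsReduced (t :: u₂ ++ y ++ [c]) :=
        hy.of_infix ⟨u₁, [], by simp [hu]⟩
      have hsuffix' : cs.IsReduced (u₂ ++ y ++ [c]) :=
        hsuffix.of_infix ⟨[t], [], by simp⟩
      have hroot : cs.IsRoot κ (cs.geomRep κ (cs.wordProd (u₂ ++ y)) (Pi.single c 1)) :=
        (isRoot_single c).map _
      have hpos := cs.geomRep_single_nonneg κ hκ (isReduced_append_singleton_iff.1 hsuffix').2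
      have hroot' : cs.IsRoot κ (cs.geomRep κ (cs.wordProd (t :: u₂ ++ y)) (Pi.single c 1)) :=
        (isRoot_single c).map _
      have hpos' := cs.geomRep_single_nonneg κ hκ (isReduced_append_singleton_iff.1 hsuffix).2
      have hvγ : cs.geomRep κ (cs.wordProd u₂) (v κ)
          = cs.geomRep κ (cs.wordProd (u₂ ++ y)) (Pi.single c 1) := by
        rw [wordProd_append, geomRep_mul_apply]
      rw [hvγ]
      have hlt : M.pairing κ t (cs.geomRep κ (cs.wordProd (u₂ ++ y)) (Pi.single c 1)) < 1 := by
        refine cs.pairing_lt_one hκ (w := cs.wordProd (u₂ ++ y ++ [c]).reverse) hroot hpos ?_ ?_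
        · rw [wordProd_reverse, cs.wordProd_append (u₂ ++ y) [c], mul_inv_rev, geomRep_mul_apply,
            geomRep_inv_apply, wordProd_singleton, inv_simple, geomRep_simple,
            simpleReflection_single_self]
          exact neg_nonpos.2 (single_nonneg c)
        · refine (isReduced_append_singleton_iff.1 ?_).2
          simpa using hsuffix.reverse
      have hlt' : M.pairing κ t
          (cs.geomRep κ (cs.wordProd (t :: u₂ ++ y)) (Pi.single c 1)) < 1 := by
        refine cs.pairing_lt_one hκ (w := cs.wordProd (x ++ u₁)) hroot' hpos' ?_ ?_
        · rw [← geomRep_mul_apply, ← wordProd_append]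
          have := cs.geomRep_single_nonpos κ hκ hdesc
          simpa [hu] using this
        · refine (isReduced_append_singleton_iff.1 (hx.of_infix ⟨[], u₂, ?_⟩)).2
          simp [hu]
      rw [List.cons_append, wordProd_cons, geomRep_mul_apply, geomRep_simple,
        pairing_simpleReflection, gram_self] at hlt'
      exact abs_lt.2 ⟨by linarith, hlt⟩
    have hzero := (cs.pairing_eq_zero_of_zigzag hG hv p key 1 le_rfl).2 hnil
    have hself : M.form 1 (v 1) (v 1) = 1 :=
      IsRoot.form_self (cs := cs) ((isRoot_single c).map _)
    rw [form, Finset.sum_eq_zero fun i _ => by rw [hzero i (hp i), mul_zero]] at hself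
    exact zero_ne_one hself

end CoxeterSystem

namespace CoxeterSystem

open CoxeterMatrix

section

variable {B : Type*} [Fintype B] [DecidableEq B] {W : Type*} [Group W] {M : CoxeterMatrix B}
  (cs : CoxeterSystem M W)

theorem isReduced_alternatingWord {i j : B} (hij : i ≠ j) {k : ℕ}
    (hk : M i j ≠ 0 → k ≤ M i j) : cs.IsReduced (alternatingWord i j k) := by
  induction k generalizing i j with
  | zero => simp [alternatingWord, IsReduced]
  | succ k ih =>
    rw [alternatingWord_succ, List.concat_eq_append, isReduced_append_singleton_iff]
    have hk' : M j i ≠ 0 → k + 1 ≤ M j i := by rwa [M.symmetric j i]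
    refine ⟨ih hij.symm fun h => (Nat.le_succ k).trans (hk' h), ?_⟩
    obtain ⟨a, b, ha, hb, hab⟩ :=
      cs.exists_nonneg_geomRep_alternatingWord 1 le_rfl hij.symm hk'
    refine cs.not_isRightDescent_of_nonneg 1 le_rfl ?_
    rw [hab]
    exact add_nonneg (smul_nonneg ha (single_nonneg j)) (smul_nonneg hb (single_nonneg i))

end

lemma isChain_alternatingWord {B : Type*} {M : CoxeterMatrix B} {i j : B} (hij : M i j ≠ 0)
    (k : ℕ) : (alternatingWord i j k).IsChain fun a b => M a b ≠ 0 := by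
  have hji : M j i ≠ 0 := by rwa [M.symmetric j i]
  rw [List.isChain_iff_getElem]
  intro t ht
  rw [length_alternatingWord] at ht
  rw [getElem_alternatingWord i j k t (by omega), getElem_alternatingWord i j k (t + 1) ht]
  by_cases h : Even (k + t)
  · have : ¬ Even (k + (t + 1)) := by grind
    simp [h, this, hij]
  · have : Even (k + (t + 1)) := by grind
    simp [h, this, hji]

/-- Every element has a reduced word that avoids a given factor, if that factor can be replaced
by a lexicographically smaller one. -/
theorem exists_isReduced_avoiding {B : Type*} [Finite B] [LinearOrder B] {W : Type*} [Group W]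
    {M : CoxeterMatrix B} (cs : CoxeterSystem M W) {q q' : List B}
    (hlen : q'.length = q.length) (hprod : cs.wordProd q' = cs.wordProd q)
    (hlt : ∀ v, q' ++ v < q ++ v) (g : W) :
    ∃ l, cs.IsReduced l ∧ cs.wordProd l = g ∧ ¬ q <:+: l := by
  let s : Set (List B) := {l | cs.IsReduced l ∧ cs.wordProd l = g}
  have hs : s.Finite := (List.finite_length_eq B (cs.length g)).subset fun l hl => by
    exact hl.1.eq.symm.trans (congrArg cs.length hl.2)
  have hne : s.Nonempty := by
    obtain ⟨l, hl, rfl⟩ := cs.exists_isReduced g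
    exact ⟨l, hl, rfl⟩
  obtain ⟨l, hl⟩ := hs.exists_minimal hne
  refine ⟨l, hl.prop.1, hl.prop.2, ?_⟩
  rintro ⟨u, v, rfl⟩
  have hword : cs.wordProd (u ++ q' ++ v) = cs.wordProd (u ++ q ++ v) := by
    simp [wordProd_append, hprod]
  have hmem : u ++ q' ++ v ∈ s := by
    refine ⟨?_, hword.trans hl.prop.2⟩
    rw [IsReduced, hword, hl.prop.1.eq]
    simp [hlen]
  refine hl.not_lt hmem ?_
  rw [List.append_assoc, List.append_assoc]
  exact List.append_left_lt (hlt v)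

/-- A finite label yields a reduced factor that can be avoided by reduced words. -/
theorem exists_avoidable {n : ℕ} {W : Type*} [Group W] {M : CoxeterMatrix (Fin n)}
    (cs : CoxeterSystem M W) (hfree : ∃ i j : Fin n, i ≠ j ∧ M i j ≠ 0) :
    ∃ q : List (Fin n), cs.IsReduced q ∧ 2 ≤ q.length ∧ (q.IsChain fun a b => M a b ≠ 0) ∧
      ∀ g, ∃ l, cs.IsReduced l ∧ cs.wordProd l = g ∧ ¬ q <:+: l := by
  obtain ⟨i, j, hij, hM⟩ := hfree
  have hji : M j i ≠ 0 := by rwa [M.symmetric j i]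
  suffices h : ∃ i j : Fin n, i ≠ j ∧ M i j ≠ 0 ∧ ∀ v,
      alternatingWord j i (M j i) ++ v < alternatingWord i j (M i j) ++ v by
    obtain ⟨i, j, hij, hM, hlt⟩ := h
    refine ⟨alternatingWord i j (M i j), cs.isReduced_alternatingWord hij fun _ => le_rfl, ?_,
      isChain_alternatingWord hM _, cs.exists_isReduced_avoiding
        (q' := alternatingWord j i (M j i)) ?_ (cs.wordProd_braidWord_eq j i) hlt⟩
    · rw [length_alternatingWord]
      exact M.two_le_of_ne hij hM
    · simp [M.symmetric j i]
  obtain ⟨k, hk⟩ := Nat.exists_eq_succ_of_ne_zero hM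
  have hk' : M j i = k + 1 := by rw [M.symmetric j i, hk]
  have hcons (a b : Fin n) : alternatingWord a b (k + 1)
      = (if Even k then b else a) :: alternatingWord a b k := alternatingWord_succ' a b k
  by_cases h : (if Even k then i else j) < (if Even k then j else i)
  · refine ⟨i, j, hij, hM, fun v => ?_⟩
    rw [hk', hk, Nat.succ_eq_add_one, hcons, hcons]
    exact List.Lex.rel h
  · refine ⟨j, i, hij.symm, hji, fun v => ?_⟩
    rw [hk', hk, Nat.succ_eq_add_one, hcons, hcons]
    refine List.Lex.rel (lt_of_le_of_ne (not_lt.1 h) ?_)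
    split_ifs
    exacts [hij.symm, hij]

end CoxeterSystem

/-- A chain for `R` can only be followed by a chain for `¬ R` in a uniquely decodable way. -/
lemma List.eq_of_append_isChain {α : Type*} {R : α → α → Prop} {a h : α} {U q : List α}
    (hU : (a :: (U ++ [h])).IsChain R) (hq : (h :: q).IsChain fun i j => ¬ R i j) (hne : q ≠ [])
    {y₁ y₂ r₁ r₂ : List α} (h₁ : y₁.getLast? = some a) (h₂ : y₂.getLast? = some a)
    (hy₁ : ¬ (h :: q) <:+: y₁) (hy₂ : ¬ (h :: q) <:+: y₂)
    (heq : y₁ ++ U ++ (h :: q) ++ r₁ = y₂ ++ U ++ (h :: q) ++ r₂) : y₁ = y₂ := by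
  wlog hle : y₁.length ≤ y₂.length generalizing y₁ y₂ r₁ r₂
  · exact (this h₂ h₁ hy₂ hy₁ heq.symm (by omega)).symm
  obtain ⟨e, rfl⟩ : y₁ <+: y₂ := by
    refine List.prefix_of_prefix_length_le (l₃ := y₁ ++ U ++ (h :: q) ++ r₁) ?_ ?_ hle
    · exact ⟨U ++ (h :: q) ++ r₁, by simp⟩
    · rw [heq]
      exact ⟨U ++ (h :: q) ++ r₂, by simp⟩
  rcases List.eq_nil_or_concat e with rfl | ⟨e, c, rfl⟩
  · simp
  exfalso
  obtain rfl : c = a := by simpa using h₂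
  have hword : U ++ (h :: q) ++ r₁ = e ++ (c :: (U ++ [h])) ++ (q ++ r₂) := by
    simpa using heq
  have hqpos : 0 < q.length := List.length_pos_iff.2 hne
  by_cases hlong : U.length + (h :: q).length ≤ e.length + 1
  · refine hy₂ (List.IsInfix.trans (l₂ := e ++ [c]) ?_ ⟨y₁, [], by simp⟩)
    have hpre : U ++ (h :: q) <+: e ++ [c] := by
      refine List.prefix_of_prefix_length_le (l₃ := U ++ (h :: q) ++ r₁) ?_ ?_
        (by simpa using hlong)
      · exact ⟨r₁, rfl⟩
      · rw [hword]
        exact ⟨U ++ [h] ++ (q ++ r₂), by simp⟩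
    obtain ⟨z, hz⟩ := hpre
    exact ⟨U, z, by simpa using hz⟩
  · obtain ⟨t, ht₁, ht₂, ht₃, ht₄⟩ : ∃ t, U.length ≤ t ∧ t < U.length + q.length ∧
        e.length ≤ t ∧ t < e.length + U.length + 1 := by
      simp only [List.length_cons] at hlong
      exact ⟨max U.length e.length, by omega, by omega, by omega, by omega⟩
    have left (t : ℕ) (h₁ : U.length ≤ t) (h₂ : t < U.length + q.length + 1) :
        (U ++ (h :: q) ++ r₁)[t]? = (h :: q)[t - U.length]? := by
      rw [List.append_assoc, List.getElem?_append_right h₁, List.getElem?_append_left]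
      simp only [List.length_cons]
      omega
    have right (t : ℕ) (h₁ : e.length ≤ t) (h₂ : t < e.length + U.length + 2) :
        (e ++ (c :: (U ++ [h])) ++ (q ++ r₂))[t]? = (c :: (U ++ [h]))[t - e.length]? := by
      rw [List.append_assoc, List.getElem?_append_right h₁, List.getElem?_append_left]
      simp only [List.length_cons, List.length_append, List.length_nil]
      omega
    have e₁ := left t ht₁ (by omega)
    have e₂ := left (t + 1) (by omega) (by omega)
    rw [hword, right t ht₃ (by omega)] at e₁
    rw [hword, right (t + 1) (by omega) (by omega)] at e₂
    rw [Nat.sub_add_comm ht₁, Nat.sub_add_comm ht₃] at e₂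
    have hR := List.isChain_iff_getElem.1 hU (t - e.length) (by simp; omega)
    have hR' := List.isChain_iff_getElem.1 hq (t - U.length) (by simp; omega)
    rw [List.getElem?_eq_getElem (by simp; omega), List.getElem?_eq_getElem (by simp; omega),
      Option.some_inj] at e₁ e₂
    rw [e₁, e₂] at hR
    exact hR' hR

namespace CoxeterSystem

variable {B : Type*} [Fintype B] [DecidableEq B] {W : Type*} [Group W] {M : CoxeterMatrix B}

/-- A word that joins reduced words and marks the end of words avoiding the factor `q`. -/
theorem exists_bridge (cs : CoxeterSystem M W) {G : SimpleGraph B} [Nontrivial B]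
    (hG : ∀ i j, G.Adj i j → M i j = 0) (hconn : G.Connected) {q : List B}
    (hq : cs.IsReduced q) (hlen : 2 ≤ q.length) (hchain : q.IsChain fun a b => M a b ≠ 0)
    (b a : B) :
    ∃ w : List B,
      (∀ y, cs.IsReduced y → y.getLast? = some a → ∀ v, cs.IsReduced v →
        (v = [] ∨ v.head? = some b) → cs.IsReduced (y ++ w ++ v)) ∧
      ∀ y₁ y₂ r₁ r₂, y₁.getLast? = some a → y₂.getLast? = some a →
        ¬ q <:+: y₁ → ¬ q <:+: y₂ → y₁ ++ w ++ r₁ = y₂ ++ w ++ r₂ → y₁ = y₂ := by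
  have hsymm (i j : B) (h : M i j = 0) : M j i = 0 := (M.symmetric j i).trans h
  obtain ⟨h, t, rfl⟩ : ∃ h t, q = h :: t := by
    cases q with
    | nil => simp at hlen
    | cons h t => exact ⟨h, t, rfl⟩
  have ht : t ≠ [] := by
    rintro rfl
    simp at hlen
  obtain ⟨z, hz⟩ : ∃ z, (h :: t).getLast? = some z := ⟨_, List.getLast?_eq_some_getLast (by simp)⟩
  obtain ⟨d, hd⟩ := hconn.preconnected.exists_adj_of_nontrivial h
  obtain ⟨d', hd'⟩ := hconn.preconnected.exists_adj_of_nontrivial b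
  obtain ⟨p, hp⟩ := hconn.exists_walk_support a d
  obtain ⟨p', hp'⟩ := hconn.exists_walk_support z d'
  have hnil {x y : B} {p : G.Walk x y} (hp : ∀ i, i ∈ p.support) : ¬ p.Nil := by
    intro hn
    obtain ⟨i, hi⟩ := exists_ne x
    cases p with
    | nil => exact hi (by simpa using hp i)
    | cons => simp at hn
  have hchain_zigzag {x y c : B} (p : G.Walk x y) (hc : G.Adj c y) :
      (x :: (p.zigzag ++ [c])).IsChain fun i j => M i j = 0 := by
    rw [← List.cons_append, List.isChain_append]
    refine ⟨p.isChain_zigzag.imp hG, by simp, fun i hi j hj => ?_⟩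
    rw [p.getLast?_zigzag, Option.mem_some_iff] at hi
    obtain rfl : c = j := by simpa using hj
    subst hi
    exact hsymm _ _ (hG _ _ hc)
  have hC := hchain_zigzag p hd
  have hC' := hchain_zigzag p' hd'
  refine ⟨p.zigzag ++ (h :: t) ++ p'.zigzag, fun y hy hya v hv hvb => ?_, ?_⟩
  · have hUq : cs.IsReduced (p.zigzag ++ (h :: t)) := hq.isChain_append (by simp) hC.tail
    have hyU : cs.IsReduced (y ++ p.zigzag) :=
      hy.append_isChain hya (hC.infix ⟨[], [h], by simp⟩)
    have hyUq := IsReduced.append_zigzag_append hG hp (hnil hp) hyU hUq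
    have hyUqV : cs.IsReduced (y ++ p.zigzag ++ (h :: t) ++ p'.zigzag) := by
      refine hyUq.append_isChain (a := z) ?_ (hC'.infix ⟨[], [b], by simp⟩)
      rw [List.getLast?_append, hz]
      simp
    rcases hvb with rfl | hvb
    · simpa using hyUqV
    · have hVv : cs.IsReduced (p'.zigzag ++ v) := hv.isChain_append hvb hC'.tail
      simpa using IsReduced.append_zigzag_append hG hp' (hnil hp') hyUqV hVv
  · intro y₁ y₂ r₁ r₂ h₁ h₂ n₁ n₂ heq
    refine List.eq_of_append_isChain hC hchain ht h₁ h₂ n₁ n₂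
      (r₁ := p'.zigzag ++ r₁) (r₂ := p'.zigzag ++ r₂) ?_
    simpa using heq

end CoxeterSystem

section Growth

open Filter Topology

/-- Fekete's lemma for submultiplicative sequences of positive integers. -/
theorem pow_limsup_rpow_inv_le {u : ℕ → ℕ} (hpos : ∀ k, 1 ≤ u k)
    (hmul : ∀ k l, u (k + l) ≤ u k * u l) :
    1 ≤ limsup (fun k : ℕ => (u k : ℝ) ^ ((k : ℝ)⁻¹)) atTop ∧
      ∀ k, limsup (fun k : ℕ => (u k : ℝ) ^ ((k : ℝ)⁻¹)) atTop ^ k ≤ u k := by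
  have hu (k : ℕ) : (0 : ℝ) < u k := by exact_mod_cast hpos k
  have hlog (k : ℕ) : 0 ≤ Real.log (u k) := Real.log_natCast_nonneg _
  have hsub : Subadditive fun k => Real.log (u k) := fun k l => by
    rw [← Real.log_mul (hu k).ne' (hu l).ne']
    exact Real.log_le_log (hu _) (by exact_mod_cast hmul k l)
  have hbdd : BddBelow (Set.range fun k : ℕ => Real.log (u k) / k) := by
    refine ⟨0, ?_⟩
    rintro _ ⟨k, rfl⟩
    exact div_nonneg (hlog k) (Nat.cast_nonneg k)
  have hlim : Tendsto (fun k : ℕ => (u k : ℝ) ^ ((k : ℝ)⁻¹)) atTop (𝓝 (Real.exp hsub.lim)) := by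
    refine ((Real.continuous_exp.tendsto _).comp (hsub.tendsto_lim hbdd)).congr fun k => ?_
    rw [Function.comp_apply, Real.rpow_def_of_pos (hu k), div_eq_mul_inv]
  rw [hlim.limsup_eq]
  refine ⟨Real.one_le_exp (ge_of_tendsto' (hsub.tendsto_lim hbdd) fun k =>
    div_nonneg (hlog k) (Nat.cast_nonneg k)), fun k => ?_⟩
  rcases Nat.eq_zero_or_pos k with rfl | hk
  · simpa using hpos 0
  · have hk' : (0 : ℝ) < k := by exact_mod_cast hk
    rw [← Real.exp_nat_mul, ← Real.exp_log (hu k), Real.exp_le_exp, mul_comm, ← le_div_iff₀ hk']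
    exact hsub.lim_le_div hbdd hk.ne'

theorem summable_mul_pow_of_limsup_lt {u : ℕ → ℕ} {N : ℕ} (hN : ∀ k, u k ≤ N ^ k) {z : ℝ}
    (hz : 0 < z) (h : limsup (fun k : ℕ => (u k : ℝ) ^ ((k : ℝ)⁻¹)) atTop < z⁻¹) :
    Summable fun k => (u k : ℝ) * z ^ k := by
  have hroot (k : ℕ) : (u k : ℝ) ^ ((k : ℝ)⁻¹) ≤ max 1 (N : ℝ) := by
    rcases Nat.eq_zero_or_pos k with rfl | hk
    · simp
    · refine le_trans ?_ (le_max_right _ _)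
      rw [Real.rpow_inv_le_iff_of_pos (by positivity) (by positivity) (by exact_mod_cast hk),
        Real.rpow_natCast]
      exact_mod_cast hN k
  obtain ⟨c, hc, hcz⟩ := exists_between h
  have hev := eventually_lt_of_limsup_lt hc (isBoundedUnder_of ⟨_, hroot⟩)
  have hc0 : 0 < c := by
    obtain ⟨k, hk⟩ := hev.exists
    exact lt_of_le_of_lt (by positivity) hk
  have hcz' : c * z < 1 := by
    rwa [← lt_div_iff₀ hz, one_div]
  refine Summable.of_norm_bounded_eventually_nat
    (summable_geometric_of_lt_one (by positivity) hcz') ?_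
  filter_upwards [hev, eventually_gt_atTop 0] with k hk hk0
  rw [Real.norm_of_nonneg (by positivity), mul_pow]
  gcongr
  rw [← Real.rpow_natCast]
  exact ((Real.rpow_inv_lt_iff_of_pos (by positivity) hc0.le (by exact_mod_cast hk0)).1 hk).le

/-- If a set of words is closed under prepending the words of a prefix code, then its generating
function diverges wherever that of the code exceeds `1`. -/
theorem not_summable_of_prefix_code {α : Type*} [Finite α] {C : Finset (List α)}
    (hC : ∀ c ∈ C, ∀ c' ∈ C, ∀ r r', c ++ r = c' ++ r' → c = c') {P : List α → Prop}
    (hnil : P []) (happ : ∀ c ∈ C, ∀ w, P w → P (c ++ w)) {z : ℝ} (hz : 0 < z)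
    (hsum : 1 < ∑ c ∈ C, z ^ c.length) :
    ¬ Summable fun k => (Nat.card {l : List α // l.length = k ∧ P l} : ℝ) * z ^ k := by
  classical
  intro hsummable
  have key (r : ℕ) : ∃ S : Finset (List α), (∀ w ∈ S, P w) ∧
      ∑ w ∈ S, z ^ w.length = (∑ c ∈ C, z ^ c.length) ^ r := by
    induction r with
    | zero => exact ⟨{[]}, by simpa using hnil, by simp⟩
    | succ r ih =>
      obtain ⟨S, hS, hSsum⟩ := ih
      refine ⟨(C ×ˢ S).image fun p => p.1 ++ p.2, ?_, ?_⟩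
      · simp only [Finset.mem_image, Finset.mem_product]
        rintro _ ⟨p, ⟨hc, hw⟩, rfl⟩
        exact happ _ hc _ (hS _ hw)
      · rw [Finset.sum_image, Finset.sum_product, pow_succ', ← hSsum, Finset.sum_mul_sum]
        · simp [pow_add]
        · rintro ⟨c, w⟩ h ⟨c', w'⟩ h' heq
          simp only [Finset.coe_product, Set.mem_prod, Finset.mem_coe] at h h' heq
          obtain rfl := hC c h.1 c' h'.1 w w' heq
          simpa using heq
  have bound (S : Finset (List α)) (hS : ∀ w ∈ S, P w) : ∑ w ∈ S, z ^ w.length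
      ≤ ∑' k, (Nat.card {l : List α // l.length = k ∧ P l} : ℝ) * z ^ k := by
    rw [← Finset.sum_fiberwise_of_maps_to (g := List.length) (t := S.image List.length)
      fun w hw => Finset.mem_image_of_mem _ hw]
    refine le_trans (Finset.sum_le_sum fun k _ => ?_)
      (hsummable.sum_le_tsum _ fun k _ => by positivity)
    rw [Finset.sum_congr rfl fun w hw => by rw [(Finset.mem_filter.1 hw).2], Finset.sum_const,
      nsmul_eq_mul]
    gcongr
    have : Finite {l : List α // l.length = k ∧ P l} :=
      ((List.finite_length_eq α k).subset fun l hl => hl.1).to_subtype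
    rw [← Nat.card_eq_finsetCard]
    refine Nat.card_le_card_of_injective
      (fun w => ⟨w.1, (Finset.mem_filter.1 w.2).2, hS _ (Finset.mem_filter.1 w.2).1⟩) ?_
    intro w w' h
    exact Subtype.ext (congrArg (fun l => l.1) h)
  obtain ⟨r, hr⟩ := ((tendsto_pow_atTop_atTop_of_one_lt hsum).eventually_gt_atTop
    (∑' k, (Nat.card {l : List α // l.length = k ∧ P l} : ℝ) * z ^ k)).exists
  obtain ⟨S, hS, hSsum⟩ := key r
  exact (bound S hS).not_gt (hSsum ▸ hr)

end Growth

namespace CoxeterSystem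

variable {n : ℕ} {W : Type*} [Group W] {M : CoxeterMatrix (Fin n)} (cs : CoxeterSystem M W)

lemma finite_length_eq (k : ℕ) : {g : W | cs.length g = k}.Finite := by
  refine ((List.finite_length_eq (Fin n) k).image cs.wordProd).subset fun g hg => ?_
  obtain ⟨l, hl, rfl⟩ := cs.exists_isReduced g
  exact ⟨l, hl.eq.symm.trans hg, rfl⟩

instance (k : ℕ) : Finite {g : W // cs.length g = k} := (cs.finite_length_eq k).to_subtype

lemma wordCount_add_le (k l : ℕ) :
    wordCount cs (k + l) ≤ wordCount cs k * wordCount cs l := by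
  rw [wordCount, wordCount, wordCount, ← Nat.card_prod]
  have key (g : {g : W // cs.length g = k + l}) : ∃ p : {g : W // cs.length g = k} ×
      {g : W // cs.length g = l}, p.1.1 * p.2.1 = g.1 := by
    obtain ⟨g, hg⟩ := g
    obtain ⟨w, hw, rfl⟩ := cs.exists_isReduced g
    rw [hw.eq] at hg
    refine ⟨⟨⟨cs.wordProd (w.take k), ?_⟩, ⟨cs.wordProd (w.drop k), ?_⟩⟩, ?_⟩
    · rw [(hw.take k).eq, List.length_take, hg]
      simp
    · rw [(hw.drop k).eq, List.length_drop, hg]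
      simp
    · simp [← wordProd_append]
  choose f hf using key
  refine Nat.card_le_card_of_injective f fun g g' h => Subtype.ext ?_
  rw [← hf g, ← hf g', h]

lemma one_le_wordCount {i j : Fin n} (hij : i ≠ j) (hM : M i j = 0) (k : ℕ) :
    1 ≤ wordCount cs k := by
  refine Nat.card_pos_iff.2 ⟨⟨cs.wordProd (alternatingWord i j k), ?_⟩, inferInstance⟩
  rw [(cs.isReduced_alternatingWord hij fun h => absurd hM h).eq, length_alternatingWord]

lemma geoCount_le_pow (k : ℕ) : geoCount cs k ≤ n ^ k := by
  have h : Nat.card (List.Vector (Fin n) k) = n ^ k := by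
    rw [Nat.card_eq_fintype_card, card_vector, Fintype.card_fin]
  rw [← h]
  exact Nat.card_le_card_of_injective (fun l => ⟨l.1, l.2.1⟩) fun l l' h =>
    Subtype.ext (congrArg (fun v : List.Vector (Fin n) k => v.1) h)

/-- The nonempty reduced words of length at most `K` that avoid the factor `q`. -/
noncomputable def avoiding (q : List (Fin n)) (K : ℕ) : Finset (List (Fin n)) :=
  ((List.finite_length_le (Fin n) K).subset
    (t := {l | l.length ≤ K ∧ l ≠ [] ∧ cs.IsReduced l ∧ ¬ q <:+: l}) fun _ h => h.1).toFinset

lemma mem_avoiding {q : List (Fin n)} {K : ℕ} {l : List (Fin n)} : l ∈ cs.avoiding q K ↔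
    l.length ≤ K ∧ l ≠ [] ∧ cs.IsReduced l ∧ ¬ q <:+: l := by
  simp [avoiding]

lemma le_sum_avoiding {q : List (Fin n)}
    (hq : ∀ g, ∃ l, cs.IsReduced l ∧ cs.wordProd l = g ∧ ¬ q <:+: l) {x : ℝ} (hx : 0 < x)
    (hcount : ∀ k, 1 ≤ wordCount cs k * x ^ k) (K : ℕ) :
    (K : ℝ) ≤ ∑ l ∈ cs.avoiding q K, x ^ l.length := by
  have hmaps : ∀ l ∈ cs.avoiding q K, l.length ∈ Finset.Icc 1 K := fun l hl => by
    rw [mem_avoiding] at hl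
    exact Finset.mem_Icc.2 ⟨List.length_pos_iff.2 hl.2.1, hl.1⟩
  rw [← Finset.sum_fiberwise_of_maps_to hmaps]
  have hK : (K : ℝ) = ∑ k ∈ Finset.Icc 1 K, (1 : ℝ) := by simp
  rw [hK]
  refine Finset.sum_le_sum fun k hk => (hcount k).trans ?_
  rw [Finset.mem_Icc] at hk
  rw [Finset.sum_congr rfl fun w hw => by rw [(Finset.mem_filter.1 hw).2], Finset.sum_const,
    nsmul_eq_mul]
  gcongr
  choose f hf using hq
  rw [← Nat.card_eq_finsetCard, wordCount]
  have hlen (g : {g : W // cs.length g = k}) : (f g.1).length = k := by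
    rw [← (hf g.1).1.eq, (hf g.1).2.1, g.2]
  refine Nat.card_le_card_of_injective (fun g => ⟨f g.1, Finset.mem_filter.2
    ⟨cs.mem_avoiding.2 ⟨(hlen g).trans_le hk.2, ?_, (hf g.1).1, (hf g.1).2.2⟩, hlen g⟩⟩) ?_
  · rw [← List.length_pos_iff, hlen]
    exact hk.1
  · intro g g' h
    have h' : f g.1 = f g'.1 := congrArg (fun l => l.1) h
    exact Subtype.ext (by rw [← (hf g.1).2.1, h', (hf g'.1).2.1])

/-- At the reciprocal of the word growth rate, some code of bridged words has weight above `1`. -/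
lemma exists_one_lt_sum_avoiding {q : List (Fin n)} [Nonempty (Fin n)]
    (hq : ∀ g, ∃ l, cs.IsReduced l ∧ cs.wordProd l = g ∧ ¬ q <:+: l) {x : ℝ} (hx : 0 < x)
    (hcount : ∀ k, 1 ≤ wordCount cs k * x ^ k) (w : Fin n → Fin n → List (Fin n)) :
    ∃ (b a : Fin n) (Y : Finset (List (Fin n))),
      (∀ y ∈ Y, cs.IsReduced y ∧ ¬ q <:+: y ∧ y.head? = some b ∧ y.getLast? = some a) ∧
      1 < ∑ y ∈ Y, x ^ (y ++ w b a).length := by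
  obtain ⟨i⟩ := ‹Nonempty (Fin n)›
  obtain ⟨K, hK⟩ := exists_nat_gt (∑ p : Fin n × Fin n, (x ^ (w p.1 p.2).length)⁻¹)
  replace hK := hK.trans_le (cs.le_sum_avoiding hq hx hcount K)
  rw [← Finset.sum_fiberwise_of_maps_to (g := fun l : List (Fin n) => (l.headD i, l.getLastD i))
    (t := Finset.univ) fun _ _ => Finset.mem_univ _] at hK
  obtain ⟨⟨b, a⟩, -, h⟩ := Finset.exists_lt_of_sum_lt hK
  refine ⟨b, a, (cs.avoiding q K).filter fun l => (l.headD i, l.getLastD i) = (b, a),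
    fun y hy => ?_, ?_⟩
  · rw [Finset.mem_filter, mem_avoiding, Prod.mk.injEq] at hy
    obtain ⟨⟨-, hne, hred, havoid⟩, rfl, rfl⟩ := hy
    refine ⟨hred, havoid, ?_, ?_⟩
    · simp [List.headD_eq_head?_getD, List.head?_eq_some_head hne]
    · simp [List.getLastD_eq_getLast?, List.getLast?_eq_some_getLast hne]
  · rw [inv_lt_iff_one_lt_mul₀' (by positivity)] at h
    simpa only [List.length_append, pow_add, ← Finset.sum_mul, mul_comm] using h

end CoxeterSystem

/-- **Theorem.** If `G` is an `∞`-spanned Coxeter group of rank `n ≥ 3` which is not a free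
product `ℤ₂ * ⋯ * ℤ₂` (i.e. `M i j ≠ 0` for some `i ≠ j`), then the geodesic growth rate
strictly dominates the word growth rate: `γ(G) > ω(G)`. -/
theorem geoGrowthRate_gt_wordGrowthRate {n : ℕ} (hn : 3 ≤ n)
    (M : CoxeterMatrix (Fin n)) (hM : M.InfSpanned)
    (hfree : ∃ i j : Fin n, i ≠ j ∧ M i j ≠ 0)
    {W : Type*} [Group W] (cs : CoxeterSystem M W) :
    wordGrowthRate cs < geoGrowthRate cs := by
  have : Nontrivial (Fin n) := Fin.nontrivial_iff_two_le.2 (by omega)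
  have hG (i j : Fin n) (h : (SimpleGraph.fromRel fun i j => M i j = 0).Adj i j) : M i j = 0 := by
    rw [SimpleGraph.fromRel_adj] at h
    rcases h.2 with h | h
    · exact h
    · exact (M.symmetric i j).trans h
  obtain ⟨q, hq, hlen, hchain, havoid⟩ := cs.exists_avoidable hfree
  obtain ⟨i, -⟩ := hfree
  obtain ⟨j, hij⟩ := hM.preconnected.exists_adj_of_nontrivial i
  obtain ⟨hone, hpow⟩ := pow_limsup_rpow_inv_le (cs.one_le_wordCount hij.ne (hG _ _ hij))
    cs.wordCount_add_le
  rw [← wordGrowthRate] at hone hpow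
  have hpos : 0 < wordGrowthRate cs := zero_lt_one.trans_le hone
  choose w hw hcode using cs.exists_bridge hG hM hq hlen hchain
  obtain ⟨b, a, Y, hY, hsum⟩ := cs.exists_one_lt_sum_avoiding havoid (inv_pos.2 hpos)
    (fun k => by
      rw [inv_pow, ← div_eq_mul_inv, one_le_div (by positivity)]
      exact hpow k) w
  obtain ⟨z, hz, hz0, hzω⟩ : ∃ z : ℝ, 1 < ∑ y ∈ Y, z ^ (y ++ w b a).length ∧ 0 < z ∧
      z < (wordGrowthRate cs)⁻¹ := by
    have hcont : Continuous fun z : ℝ => ∑ y ∈ Y, z ^ (y ++ w b a).length := by fun_prop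
    have hnear : ∀ᶠ z in nhdsWithin (wordGrowthRate cs)⁻¹ (Set.Iio (wordGrowthRate cs)⁻¹),
        1 < ∑ y ∈ Y, z ^ (y ++ w b a).length :=
      (hcont.continuousAt.eventually (lt_mem_nhds hsum)).filter_mono nhdsWithin_le_nhds
    exact (hnear.and (Ioo_mem_nhdsLT (inv_pos.2 hpos))).exists
  by_contra! hle
  have hsummable := summable_mul_pow_of_limsup_lt cs.geoCount_le_pow hz0
    (hle.trans_lt ((lt_inv_comm₀ hz0 hpos).1 hzω))
  refine not_summable_of_prefix_code (C := Y.image (· ++ w b a)) (z := z)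
    (P := fun l => cs.IsReduced l ∧ (l = [] ∨ l.head? = some b)) ?_ ?_ ?_ hz0 ?_ ?_
  · simp only [Finset.mem_image]
    rintro _ ⟨y, hy, rfl⟩ _ ⟨y', hy', rfl⟩ r r' h
    rw [hcode b a y y' r r' (hY y hy).2.2.2 (hY y' hy').2.2.2 (hY y hy).2.1 (hY y' hy').2.1 h]
  · exact ⟨by simp [CoxeterSystem.IsReduced], Or.inl rfl⟩
  · simp only [Finset.mem_image]
    rintro _ ⟨y, hy, rfl⟩ v hv
    refine ⟨hw b a y (hY y hy).1 (hY y hy).2.2.2 v hv.1 hv.2, Or.inr ?_⟩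
    simp [(hY y hy).2.2.1]
  · rwa [Finset.sum_image fun y _ y' _ h => List.append_cancel_right h]
  · refine Summable.of_nonneg_of_le (fun k => by positivity) (fun k => ?_) hsummable
    gcongr
    have : Finite {l : List (Fin n) // l.length = k ∧ cs.length (cs.wordProd l) = k} :=
      ((List.finite_length_eq (Fin n) k).subset fun l hl => hl.1).to_subtype
    exact Nat.card_le_card_of_injective
      (fun l => ⟨l.1, l.2.1, l.2.2.1.eq.trans l.2.1⟩)
      fun l l' h => Subtype.ext (congrArg (fun l => l.1) h)
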